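/- Theorem C: No piecewise affine map is infinitely renormalizable. That is, there is no f ∈ PL([0,1]) admitting an infinite sequence of nested cycles 𝓘¹ ⊃ 𝓘² ⊃ 𝓘³ ⊃ ⋯ whose numbers of intervals are strictly increasing, 2 ≤ q₁ < q₂ < q₃ < ⋯. -/

import Mathlib

/-- `f` is a piecewise affine map of `[0,1]` into itself: continuous, and affine with
nonzero slope on each interval of some finite partition `0 = a 0 < a 1 < ⋯ < a d = 1`. -/
def IsPLMap (f : ℝ → ℝ) : Prop :=
  ContinuousOn f (Set.Icc 0 1) ∧ Set.MapsTo f (Set.Icc 0 1) (Set.Icc 0 1) ∧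
    ∃ (d : ℕ) (a s c : ℕ → ℝ), 1 ≤ d ∧ a 0 = 0 ∧ a d = 1 ∧
      (∀ i < d, a i < a (i + 1)) ∧ (∀ i < d, s i ≠ 0) ∧
      (∀ i < d, ∀ x ∈ Set.Icc (a i) (a (i + 1)), f x = s i * x + c i)

/-- The set of corner points of `f`: interior points of `[0,1]` where the two
one-sided derivatives (slopes) of `f` differ. -/
def cornerSet (f : ℝ → ℝ) : Set ℝ :=
  {x | x ∈ Set.Ioo (0 : ℝ) 1 ∧
    derivWithin f (Set.Ici x) x ≠ derivWithin f (Set.Iic x) x}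

/-- `V = Var(log |Df|)`, the total variation of `log |Df|` over `[0,1]`, i.e. the sum
over the corner points of `f` of the jumps of `log |Df|` there. -/
noncomputable def logSlopeVar (f : ℝ → ℝ) : ℝ :=
  ∑ᶠ x ∈ cornerSet f,
    |Real.log (|derivWithin f (Set.Ici x) x|) - Real.log (|derivWithin f (Set.Iic x) x|)|

/-- `I 0, …, I (q-1)` is a cycle of `f`: pairwise disjoint nondegenerate closed
subintervals of `[0,1]` mapped cyclically into one another by `f`. -/
def IsCycle (f : ℝ → ℝ) (q : ℕ) (I : ℕ → Set ℝ) : Prop :=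
  1 ≤ q ∧ (∀ j < q, ∃ u v : ℝ, u < v ∧ I j = Set.Icc u v) ∧
    (∀ j < q, I j ⊆ Set.Icc 0 1) ∧
    (∀ i < q, ∀ j < q, i ≠ j → Disjoint (I i) (I j)) ∧
    (∀ j < q, f '' I j ⊆ I ((j + 1) % q))

/-- The union `∪𝓘` of the intervals of a cycle. -/
def cycleUnion (q : ℕ) (I : ℕ → Set ℝ) : Set ℝ := ⋃ j < q, I j

/-- `𝓘¹ ⊃ 𝓘²`, the cycles are nested: every interval of the cycle `𝓘²` is contained in
some interval of the cycle `𝓘¹`, and the two collections of intervals are different. -/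
def CycleNested (q₁ : ℕ) (I1 : ℕ → Set ℝ) (q₂ : ℕ) (I2 : ℕ → Set ℝ) : Prop :=
  (∀ j < q₂, ∃ i < q₁, I2 j ⊆ I1 i) ∧ I2 '' Set.Iio q₂ ≠ I1 '' Set.Iio q₁

/-- `G` is a gap of the cycle `I2`, with left neighbour `I2 l` and right neighbour
`I2 r`: an open interval disjoint from `∪𝓘²` lying strictly between the two adjacent
intervals `I2 l` and `I2 r` (whose closures it meets). -/
def IsGap (q₂ : ℕ) (I2 : ℕ → Set ℝ) (l r : ℕ) (G : Set ℝ) : Prop :=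
  l < q₂ ∧ r < q₂ ∧
    ∃ a b : ℝ, a < b ∧ G = Set.Ioo a b ∧
      a ∈ I2 l ∧ (∀ y ∈ I2 l, y ≤ a) ∧ b ∈ I2 r ∧ (∀ y ∈ I2 r, b ≤ y) ∧
      ∀ j < q₂, Disjoint G (I2 j)

/-- `P` is a splitting for the nested pair of cycles `𝓘¹ ⊃ 𝓘²`: a finite union of
periodic orbits of `f` such that every point of `P` lies in a gap and every gap
contains exactly one point of `P`. -/
def IsSplitting (f : ℝ → ℝ) (q₁ : ℕ) (I1 : ℕ → Set ℝ) (q₂ : ℕ) (I2 : ℕ → Set ℝ)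
    (P : Set ℝ) : Prop :=
  P.Finite ∧ Set.MapsTo f P P ∧ (∀ x ∈ P, ∃ p, 1 ≤ p ∧ f^[p] x = x) ∧
    (∀ x ∈ P, ∃ i < q₁, ∃ l r G, IsGap q₂ I2 l r G ∧ G ⊆ I1 i ∧ x ∈ G) ∧
    (∀ i < q₁, ∀ l r G, IsGap q₂ I2 l r G → G ⊆ I1 i → ∃! x, x ∈ P ∩ G)

/-- The cycle `I2` (with `q₂` intervals) is a doubling of the cycle `I` (with `q`
intervals): `I` is a cycle, `𝓘 ⊃ 𝓘²`, and `q₂ = 2q`. -/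
def IsDoublingOf (f : ℝ → ℝ) (q₂ : ℕ) (I2 : ℕ → Set ℝ) (q : ℕ) (I : ℕ → Set ℝ) : Prop :=
  IsCycle f q I ∧ CycleNested q I q₂ I2 ∧ q₂ = 2 * q

/-- `x` is a periodic point of `f` of minimal period `p`. -/
def MinimalPeriod (f : ℝ → ℝ) (x : ℝ) (p : ℕ) : Prop :=
  1 ≤ p ∧ f^[p] x = x ∧ ∀ k, 1 ≤ k → k < p → f^[k] x ≠ x

/-- `B` is a finite set of breakpoints containing those of the piecewise affine map `f` of
`[0,1]`, and `φ x` is the logarithm of the absolute value of the slope of `f` to the right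
of `x`. -/
structure IsLogSlope (f : ℝ → ℝ) (B : Finset ℝ) (φ : ℝ → ℝ) : Prop where
  cont : ContinuousOn f (Set.Icc 0 1)
  maps : Set.MapsTo f (Set.Icc 0 1) (Set.Icc 0 1)
  zero_mem : (0 : ℝ) ∈ B
  one_mem : (1 : ℝ) ∈ B
  finite_range : (Set.range φ).Finite
  affine : ∀ x y : ℝ, 0 ≤ x → x < y → y ≤ 1 → (∀ b ∈ B, x < b → y ≤ b) →
    ∃ s : ℝ, |s| = Real.exp (φ x) ∧ ∀ z ∈ Set.Icc x y, f z = f x + s * (z - x)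
  const : ∀ x y : ℝ, 0 ≤ x → x ≤ y → y ≤ 1 → (∀ b ∈ B, x < b → y < b) → φ x = φ y

theorem IsPLMap.exists_isLogSlope {f : ℝ → ℝ} (hf : IsPLMap f) :
    ∃ B φ, IsLogSlope f B φ := by
  obtain ⟨hc, hm, d, a, s, c, hd, ha0, had, hlt, hs, haff⟩ := hf
  let ι : ℝ → ℕ := fun x => Nat.findGreatest (fun i => a i ≤ x) (d - 1)
  have hι : ∀ x, ι x < d := fun x => by
    have : ι x ≤ d - 1 := Nat.findGreatest_le _
    omega
  have hιle : ∀ x, 0 ≤ x → a (ι x) ≤ x := fun x hx =>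
    Nat.findGreatest_spec (P := fun i => a i ≤ x) (Nat.zero_le _) (by rw [ha0]; exact hx)
  have hB : ∀ i ≤ d, a i ∈ (Finset.range (d + 1)).image a := fun i hi =>
    Finset.mem_image_of_mem _ (Finset.mem_range.2 (by omega))
  refine ⟨(Finset.range (d + 1)).image a, fun x => Real.log |s (ι x)|, hc, hm, ?_, ?_, ?_, ?_, ?_⟩
  · exact ha0 ▸ hB 0 (Nat.zero_le _)
  · simpa only [had] using hB d le_rfl
  · refine ((Finset.range d).finite_toSet.image fun i => Real.log |s i|).subset ?_
    rintro _ ⟨x, rfl⟩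
    exact ⟨ι x, by simpa using hι x, rfl⟩
  · intro x y hx hxy hy hb
    have hy' : y ≤ a (ι x + 1) := by
      rcases Nat.lt_or_ge (ι x) (d - 1) with h | h
      · refine hb _ (hB _ (by omega)) ?_
        have := Nat.findGreatest_is_greatest (P := fun i => a i ≤ x) (n := d - 1)
          (k := ι x + 1) (Nat.lt_succ_self _) (by omega)
        exact not_le.1 this
      · have h1 := hι x
        have h2 : ι x + 1 = d := by omega
        rw [h2, had]; exact hy
    refine ⟨s (ι x), ?_, fun z hz => ?_⟩
    · rw [Real.exp_log (abs_pos.2 (hs _ (hι x)))]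
    · have h1 := hιle x hx
      rw [haff _ (hι x) z ⟨h1.trans hz.1, hz.2.trans hy'⟩,
        haff _ (hι x) x ⟨h1, hxy.le.trans hy'⟩]
      ring
  · intro x y hx hxy hy hb
    have : ι x = ι y := by
      apply le_antisymm
      · exact Nat.findGreatest_mono_left (fun i hi => le_trans hi hxy) _
      · refine Nat.le_findGreatest (Nat.findGreatest_le _) ?_
        by_contra h
        have h1 := hb _ (hB (ι y) (hι y).le) (not_le.1 h)
        exact absurd (hιle y (hx.trans hxy)) (not_le.2 h1)
    simp only [this]

/-- A nontrivial subinterval has a large piece without breakpoints in its interior. -/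
theorem exists_subinterval_avoiding (B : Finset ℝ) (k : ℕ) : ∀ u v : ℝ, u < v →
    (B.filter fun b => u < b ∧ b < v).card ≤ k →
    ∃ x y, u ≤ x ∧ x < y ∧ y ≤ v ∧ (∀ b ∈ B, x < b → y ≤ b) ∧ v - u ≤ 2 ^ k * (y - x) := by
  induction k with
  | zero =>
    intro u v huv h
    refine ⟨u, v, le_rfl, huv, le_rfl, fun b hb hub => ?_, by simp⟩
    by_contra hbv
    have : b ∈ B.filter fun b => u < b ∧ b < v :=
      Finset.mem_filter.2 ⟨hb, hub, not_le.1 hbv⟩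
    rw [Finset.card_eq_zero.1 (Nat.le_zero.1 h)] at this
    simp at this
  | succ k ih =>
    intro u v huv h
    by_cases hB : ∃ b ∈ B, u < b ∧ b < v
    · obtain ⟨b, hb, hub, hbv⟩ := hB
      have hcard : ∀ u' v', u ≤ u' → v' ≤ v → ¬ (u' < b ∧ b < v') →
          (B.filter fun b => u' < b ∧ b < v').card ≤ k := by
        intro u' v' hu hv hbn
        refine Nat.le_of_lt_succ (lt_of_lt_of_le (Finset.card_lt_card ?_) h)
        refine Finset.ssubset_iff_of_subset ?_ |>.2 ⟨b, ?_, ?_⟩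
        · intro z hz
          rw [Finset.mem_filter] at hz ⊢
          exact ⟨hz.1, hu.trans_lt hz.2.1, hz.2.2.trans_le hv⟩
        · exact Finset.mem_filter.2 ⟨hb, hub, hbv⟩
        · exact fun hz => hbn (Finset.mem_filter.1 hz).2
      rcases le_total (v - b) (b - u) with hle | hle
      · obtain ⟨x, y, h1, h2, h3, h4, h5⟩ :=
          ih u b hub (hcard u b le_rfl hbv.le fun h => lt_irrefl _ h.2)
        exact ⟨x, y, h1, h2, h3.trans hbv.le, h4, by rw [pow_succ]; linarith⟩
      · obtain ⟨x, y, h1, h2, h3, h4, h5⟩ :=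
          ih b v hbv (hcard b v hub.le le_rfl fun h => lt_irrefl _ h.1)
        exact ⟨x, y, hub.le.trans h1, h2, h3, h4, by rw [pow_succ]; linarith⟩
    · refine ⟨u, v, le_rfl, huv, le_rfl, fun b hb hub => ?_, ?_⟩
      · by_contra hbv
        exact hB ⟨b, hb, hub, not_le.1 hbv⟩
      · have : (1 : ℝ) ≤ 2 ^ (k + 1) := one_le_pow₀ (by norm_num)
        nlinarith

namespace IsLogSlope

variable {f : ℝ → ℝ} {B : Finset ℝ} {φ : ℝ → ℝ}

theorem exists_bound (hf : IsLogSlope f B φ) : ∃ C, 0 ≤ C ∧ ∀ x, |φ x| ≤ C := by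
  obtain ⟨C, hC⟩ := hf.finite_range.isBounded.exists_norm_le
  exact ⟨C, (norm_nonneg _).trans (hC _ ⟨0, rfl⟩), fun x => hC _ ⟨x, rfl⟩⟩

theorem abs_sub_eq (hf : IsLogSlope f B φ) {x y : ℝ} (hx : 0 ≤ x) (hxy : x < y) (hy : y ≤ 1)
    (hb : ∀ b ∈ B, x < b → y ≤ b) : |f y - f x| = Real.exp (φ x) * (y - x) := by
  obtain ⟨s, hs, h⟩ := hf.affine x y hx hxy hy hb
  rw [h y ⟨hxy.le, le_rfl⟩, add_sub_cancel_left, abs_mul, hs, abs_of_pos (sub_pos.2 hxy)]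

/-- Near a point whose orbit avoids the breakpoints, the iterate `f^[t]` is affine. -/
theorem iterate_affine_near (hf : IsLogSlope f B φ) (t : ℕ) {x : ℝ} (hx : x ∈ Set.Icc (0 : ℝ) 1)
    (hB : ∀ i < t, f^[i] x ∉ B) :
    ∃ ε > 0, ∃ s : ℝ, |s| = Real.exp (∑ i ∈ Finset.range t, φ (f^[i] x)) ∧
      ∀ h, |h| < ε → f^[t] (x + h) = f^[t] x + s * h := by
  induction t with
  | zero => exact ⟨1, one_pos, 1, by simp, by simp⟩
  | succ t ih =>
    obtain ⟨ε, hε, s, hs, haff⟩ := ih fun i hi => hB i (by omega)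
    set y := f^[t] x with hy
    have hyB : y ∉ B := hB t (by omega)
    have hy01 : y ∈ Set.Icc (0 : ℝ) 1 := by
      rw [hy]
      exact hf.maps.iterate t hx
    have hy0 : 0 < y := lt_of_le_of_ne hy01.1 fun h => hyB (h ▸ hf.zero_mem)
    have hy1 : y < 1 := lt_of_le_of_ne hy01.2 fun h => hyB (h ▸ hf.one_mem)
    have hnear : ∀ᶠ η in nhdsWithin (0 : ℝ) (Set.Ioi 0), ∀ b ∈ B, η ≤ |b - y| := by
      rw [Filter.eventually_all_finset]
      intro b hb
      have : 0 < |b - y| := abs_pos.2 (sub_ne_zero.2 fun h => hyB (h ▸ hb))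
      filter_upwards [Ioo_mem_nhdsGT this] with η hη using hη.2.le
    obtain ⟨η, hηB, hη⟩ := (hnear.and (Ioo_mem_nhdsGT (lt_min hy0 (sub_pos.2 hy1)))).exists
    have hη0 := hη.1
    have hηy := hη.2.trans_le (min_le_left _ _)
    have hη1 := hη.2.trans_le (min_le_right _ _)
    have hsep : ∀ b ∈ B, b ≤ y - η ∨ y + η ≤ b := by
      intro b hb
      rcases le_abs.1 (hηB b hb) with h | h
      · right; linarith
      · left; linarith
    obtain ⟨r, hr, hraff⟩ := hf.affine (y - η) (y + η) (by linarith) (by linarith) (by linarith)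
      fun b hb h => (hsep b hb).resolve_left (not_le.2 h)
    have hφ : φ (y - η) = φ y := hf.const _ _ (by linarith) (by linarith) hy01.2
      fun b hb h => by have := (hsep b hb).resolve_left (not_le.2 h); linarith
    refine ⟨min ε (η / (|s| + 1)), lt_min hε (by positivity), r * s, ?_, fun h hh => ?_⟩
    · rw [abs_mul, hr, hs, Finset.sum_range_succ, hφ, add_comm, Real.exp_add]
    · have h1 := haff h (hh.trans_le (min_le_left _ _))
      have h2 : |s * h| < η := by
        have h3 := hh.trans_le (min_le_right _ _)
        rw [lt_div_iff₀ (by positivity)] at h3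
        rw [abs_mul]
        nlinarith [abs_nonneg h, abs_nonneg s]
      have h3 := abs_lt.1 h2
      rw [Function.iterate_succ_apply', Function.iterate_succ_apply', h1, ← hy,
        hraff (y + s * h) ⟨by linarith, by linarith⟩, hraff y ⟨by linarith, by linarith⟩]
      ring

end IsLogSlope

/-- In a sequence of `m + 1` distinct numbers one can choose distinct values, one between each
pair of consecutive terms. -/
theorem exists_injOn_between (m : ℕ) : ∀ y : ℕ → ℕ, Set.InjOn y (Set.Iic m) →
    ∃ t : ℕ → ℕ, Set.InjOn t (Set.Iio m) ∧ ∀ k < m, t k ∈ y '' Set.Iic m ∧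
      min (y k) (y (k + 1)) ≤ t k ∧ t k < max (y k) (y (k + 1)) := by
  induction m with
  | zero => exact fun y _ => ⟨id, by simp, by simp⟩
  | succ m ih =>
    intro y hy
    obtain ⟨t, ht, hbt⟩ := ih (fun k => y (k + 1)) fun a ha b hb h => by
      have := hy (by simp at ha ⊢; omega) (by simp at hb ⊢; omega) h
      omega
    have hyne : ∀ k ≤ m, y (k + 1) ≠ y 0 := fun k hk h => by
      have := hy (by simp; omega) (by simp) h
      omega
    have htne : ∀ k < m, t k ≠ y 0 := by
      intro k hk
      obtain ⟨j, hj, hjt⟩ := (hbt k hk).1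
      exact hjt ▸ hyne j hj
    have hmem : ∀ k < m, t k ∈ y '' Set.Iic (m + 1) := by
      intro k hk
      obtain ⟨j, hj, hjt⟩ := (hbt k hk).1
      exact ⟨j + 1, by simp at hj ⊢; omega, hjt⟩
    -- extending an assignment for the tail by a fresh value `c` for the first pair
    have key : ∀ (t' : ℕ → ℕ) (c : ℕ), Set.InjOn t' (Set.Iio m) →
        (∀ k < m, t' k ∈ y '' Set.Iic (m + 1) ∧
          min (y (k + 1)) (y (k + 2)) ≤ t' k ∧ t' k < max (y (k + 1)) (y (k + 2))) →
        (∀ k < m, t' k ≠ c) → c ∈ y '' Set.Iic (m + 1) →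
        min (y 0) (y 1) ≤ c → c < max (y 0) (y 1) →
        ∃ t : ℕ → ℕ, Set.InjOn t (Set.Iio (m + 1)) ∧ ∀ k < m + 1, t k ∈ y '' Set.Iic (m + 1) ∧
          min (y k) (y (k + 1)) ≤ t k ∧ t k < max (y k) (y (k + 1)) := by
      intro t' c hinj hb hc hcm h1 h2
      refine ⟨fun k => Nat.casesOn k c t', ?_, ?_⟩
      · rintro (_ | a) ha (_ | b) hb h
        · rfl
        · exact absurd h.symm (hc b (by simpa using hb))
        · exact absurd h (hc a (by simpa using ha))
        · rw [hinj (by simpa using ha) (by simpa using hb) h]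
      · rintro (_ | k) hk
        · exact ⟨hcm, h1, h2⟩
        · exact hb k (by omega)
    have hb' : ∀ k < m, t k ∈ y '' Set.Iic (m + 1) ∧
          min (y (k + 1)) (y (k + 2)) ≤ t k ∧ t k < max (y (k + 1)) (y (k + 2)) :=
      fun k hk => ⟨hmem k hk, (hbt k hk).2⟩
    have h0mem : y 0 ∈ y '' Set.Iic (m + 1) := ⟨0, by simp, rfl⟩
    rcases Nat.lt_or_ge (y 0) (y 1) with h01 | h01
    · exact key t (y 0) ht hb' htne h0mem (min_le_left _ _) (lt_max_of_lt_right h01)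
    · have h10 : y 1 < y 0 := lt_of_le_of_ne h01 (hyne 0 (Nat.zero_le _))
      obtain ⟨p, hp, hpmax⟩ := Finset.exists_max_image
        ((Finset.Icc 1 (m + 1)).filter fun j => y j < y 0) y ⟨1, by simp [h10]⟩
      simp only [Finset.mem_filter, Finset.mem_Icc] at hp hpmax
      have h1p : y 1 ≤ y p := hpmax 1 ⟨⟨le_rfl, by omega⟩, h10⟩
      have hpmem : y p ∈ y '' Set.Iic (m + 1) := ⟨p, by simp; omega, rfl⟩
      by_cases hex : ∃ k < m, t k = y p
      · obtain ⟨k, hk, hkp⟩ := hex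
        refine key (Function.update t k (y 0)) (y p) ?_ ?_ ?_ hpmem
          ((min_le_right _ _).trans h1p) (lt_max_of_lt_left hp.2)
        · intro a ha b hb h
          by_cases hak : a = k <;> by_cases hbk : b = k
          · rw [hak, hbk]
          · subst hak
            rw [Function.update_self, Function.update_of_ne hbk] at h
            exact absurd h.symm (htne b hb)
          · subst hbk
            rw [Function.update_self, Function.update_of_ne hak] at h
            exact absurd h (htne a ha)
          · rw [Function.update_of_ne hak, Function.update_of_ne hbk] at h
            exact ht ha hb h
        · intro j hj
          by_cases hjk : j = k
          · subst hjk
            rw [Function.update_self]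
            obtain ⟨_, hlo, hhi⟩ := hb' j hj
            rw [hkp] at hlo hhi
            have hup : ∀ i, 1 ≤ i → i ≤ m + 1 → y p < y i → y 0 < y i := by
              intro i hi1 hi2 hi
              by_contra hcon
              have hne : y i ≠ y 0 := by
                have := hyne (i - 1) (by omega)
                rwa [Nat.sub_add_cancel hi1] at this
              exact absurd (hpmax i ⟨⟨hi1, hi2⟩, by omega⟩) (by omega)
            refine ⟨h0mem, hlo.trans hp.2.le, ?_⟩
            rcases lt_max_iff.1 hhi with h | h
            · exact lt_max_of_lt_left (hup _ (by omega) (by omega) h)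
            · exact lt_max_of_lt_right (hup _ (by omega) (by omega) h)
          · rw [Function.update_of_ne hjk]
            exact hb' j hj
        · intro j hj
          by_cases hjk : j = k
          · subst hjk
            rw [Function.update_self]
            exact hp.2.ne'
          · rw [Function.update_of_ne hjk, ← hkp]
            exact fun h => hjk (ht hj hk h)
      · push Not at hex
        exact key t (y p) ht hb' hex hpmem
          ((min_le_right _ _).trans h1p) (lt_max_of_lt_left hp.2)

/-- The first `n` terms of a real sequence can be sorted. -/
theorem exists_perm_monotoneOn (n : ℕ) (u : ℕ → ℝ) :
    ∃ σ : Equiv.Perm ℕ, (∀ k, σ k < n ↔ k < n) ∧ MonotoneOn (u ∘ σ) (Set.Iio n) := by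
  let e : Equiv.Perm (Fin n) := Tuple.sort fun j : Fin n => u j
  have hval : ∀ k (h : k < n), e.extendDomain Fin.equivSubtype k = e ⟨k, h⟩ := fun k h =>
    Equiv.Perm.extendDomain_apply_subtype e Fin.equivSubtype h
  have hval' : ∀ k, ¬ k < n → e.extendDomain Fin.equivSubtype k = k := fun k h =>
    Equiv.Perm.extendDomain_apply_not_subtype e Fin.equivSubtype h
  refine ⟨e.extendDomain Fin.equivSubtype, fun k => ?_, fun a ha b hb hab => ?_⟩
  · by_cases h : k < n
    · rw [hval k h]
      exact ⟨fun _ => h, fun _ => (e ⟨k, h⟩).2⟩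
    · rw [hval' k h]
  · have := Tuple.monotone_sort (fun j : Fin n => u j)
      (show (⟨a, ha⟩ : Fin n) ≤ ⟨b, hb⟩ from hab)
    simp only [Function.comp_apply, hval a ha, hval b hb]
    exact this

/-- Sums of boundedly many terms from a finite set take finitely many values. -/
theorem exists_finite_sums {F : Set ℝ} (hF : F.Finite) (k : ℕ) :
    ∃ D : Set ℝ, D.Finite ∧ ∀ (S : Finset ℕ) (g : ℕ → ℝ), S.card ≤ k → (∀ i ∈ S, g i ∈ F) →
      ∑ i ∈ S, g i ∈ D := by
  induction k with
  | zero =>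
    refine ⟨{0}, Set.finite_singleton 0, fun S g hS _ => ?_⟩
    simp [Finset.card_eq_zero.1 (Nat.le_zero.1 hS)]
  | succ k ih =>
    obtain ⟨D, hD, h⟩ := ih
    refine ⟨insert 0 (Set.image2 (· + ·) F D), (hF.image2 _ hD).insert 0, fun S g hS hg => ?_⟩
    rcases S.eq_empty_or_nonempty with rfl | ⟨i, hi⟩
    · simp
    · right
      rw [← Finset.add_sum_erase S g hi]
      refine ⟨_, hg i hi, _, h _ g ?_ fun j hj => hg j (Finset.mem_of_mem_erase hj), rfl⟩
      rw [Finset.card_erase_of_mem hi]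
      omega

/-- The intervals `[u j, v j]`, `j < q`, form a cycle of `f`. -/
structure IsIntervalCycle (f : ℝ → ℝ) (q : ℕ) (u v : ℕ → ℝ) : Prop where
  pos : 0 < q
  lt : ∀ j < q, u j < v j
  sub : ∀ j < q, Set.Icc (u j) (v j) ⊆ Set.Icc 0 1
  eq_of_mem : ∀ i < q, ∀ j < q, ∀ x, x ∈ Set.Icc (u i) (v i) → x ∈ Set.Icc (u j) (v j) → i = j
  map : ∀ j < q, ∀ x ∈ Set.Icc (u j) (v j),
    f x ∈ Set.Icc (u ((j + 1) % q)) (v ((j + 1) % q))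

theorem IsCycle.exists_isIntervalCycle {f : ℝ → ℝ} {q : ℕ} {I : ℕ → Set ℝ} (h : IsCycle f q I) :
    ∃ u v : ℕ → ℝ, IsIntervalCycle f q u v ∧ ∀ j < q, I j = Set.Icc (u j) (v j) := by
  obtain ⟨hq, hI, hsub, hdisj, hmap⟩ := h
  choose! u v huv hIuv using hI
  have hmod : ∀ j, (j + 1) % q < q := fun j => Nat.mod_lt _ hq
  refine ⟨u, v, ⟨hq, huv, fun j hj => hIuv j hj ▸ hsub j hj, fun i hi j hj x hxi hxj => ?_,
    fun j hj x hx => ?_⟩, hIuv⟩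
  · by_contra hij
    rw [← hIuv i hi] at hxi
    rw [← hIuv j hj] at hxj
    exact Set.disjoint_left.1 (hdisj i hi j hj hij) hxi hxj
  · rw [← hIuv j hj] at hx
    rw [← hIuv _ (hmod j)]
    exact hmap j hj ⟨x, hx, rfl⟩

/-- The union of the intervals `[u j, v j]`, `j < q`. -/
def intervalUnion (q : ℕ) (u v : ℕ → ℝ) : Set ℝ := {x | ∃ j < q, x ∈ Set.Icc (u j) (v j)}

theorem isCompact_intervalUnion (q : ℕ) (u v : ℕ → ℝ) : IsCompact (intervalUnion q u v) := by
  have : intervalUnion q u v = ⋃ j ∈ Set.Iio q, Set.Icc (u j) (v j) := by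
    ext x
    simp only [intervalUnion, Set.mem_ofPred_eq, Set.mem_iUnion, Set.mem_Iio, exists_prop]
  rw [this]
  exact (Set.finite_Iio q).isCompact_biUnion fun j _ => isCompact_Icc

namespace IsIntervalCycle

variable {f : ℝ → ℝ} {q Q : ℕ} {u v u' v' : ℕ → ℝ} {B : Finset ℝ} {φ : ℝ → ℝ}

theorem iterate_mem (h : IsIntervalCycle f q u v) {j : ℕ} (hj : j < q) {x : ℝ}
    (hx : x ∈ Set.Icc (u j) (v j)) (t : ℕ) :
    f^[t] x ∈ Set.Icc (u ((j + t) % q)) (v ((j + t) % q)) := by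
  induction t with
  | zero => simpa [Nat.mod_eq_of_lt hj] using hx
  | succ t ih =>
    rw [Function.iterate_succ_apply']
    have := h.map _ (Nat.mod_lt _ h.pos) _ ih
    rwa [Nat.mod_add_mod, add_assoc] at this

theorem le_of_iterate_eq (h : IsIntervalCycle f q u v) {x : ℝ} (hx : x ∈ intervalUnion q u v)
    {t : ℕ} (ht : 0 < t) (hfx : f^[t] x = x) : q ≤ t := by
  obtain ⟨j, hj, hxj⟩ := hx
  have h1 := h.iterate_mem hj hxj t
  rw [hfx] at h1
  have h2 : j = (j + t) % q := h.eq_of_mem _ hj _ (Nat.mod_lt _ h.pos) x hxj h1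
  have h3 : (j + 0) % q = (j + t) % q := by rw [← h2, add_zero, Nat.mod_eq_of_lt hj]
  have h4 : 0 ≡ t [MOD q] := Nat.ModEq.add_left_cancel' j h3
  exact Nat.le_of_dvd ht (Nat.modEq_zero_iff_dvd.1 h4.symm)

theorem iterate_mem_union (h : IsIntervalCycle f q u v) {x : ℝ} (hx : x ∈ intervalUnion q u v)
    (t : ℕ) : f^[t] x ∈ intervalUnion q u v := by
  obtain ⟨j, hj, hxj⟩ := hx
  exact ⟨_, Nat.mod_lt _ h.pos, h.iterate_mem hj hxj t⟩

/-- If every interval of a cycle lies in an interval of another cycle, then every interval of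
the latter contains an interval of the former. -/
theorem exists_subset (h : IsIntervalCycle f q u v) (h' : IsIntervalCycle f Q u' v')
    (hsub : ∀ j < Q, ∃ i < q, Set.Icc (u' j) (v' j) ⊆ Set.Icc (u i) (v i)) {i : ℕ} (hi : i < q) :
    ∃ j < Q, Set.Icc (u' j) (v' j) ⊆ Set.Icc (u i) (v i) := by
  obtain ⟨i₀, hi₀, h₀⟩ := hsub 0 h'.pos
  have hx : u' 0 ∈ Set.Icc (u' 0) (v' 0) := ⟨le_rfl, (h'.lt 0 h'.pos).le⟩
  have hj : (0 + (i + q - i₀)) % Q < Q := Nat.mod_lt _ h'.pos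
  have h1 := h.iterate_mem hi₀ (h₀ hx) (i + q - i₀)
  have h2 := h'.iterate_mem h'.pos hx (i + q - i₀)
  obtain ⟨k, hk, hjk⟩ := hsub _ hj
  have h3 : (i₀ + (i + q - i₀)) % q = i := by
    rw [show i₀ + (i + q - i₀) = i + q by omega, Nat.add_mod_right, Nat.mod_eq_of_lt hi]
  rw [h3] at h1
  have := h.eq_of_mem _ hi _ hk _ h1 (hjk h2)
  exact ⟨_, hj, this ▸ hjk⟩

open Classical in
theorem card_filter_le (h : IsIntervalCycle f q u v) (B : Finset ℝ) :
    ((Finset.range q).filter fun i => ∃ b ∈ B, b ∈ Set.Icc (u i) (v i)).card ≤ B.card := by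
  have hex : ∀ i ∈ (Finset.range q).filter fun i => ∃ b ∈ B, b ∈ Set.Icc (u i) (v i),
      ∃ b ∈ B, b ∈ Set.Icc (u i) (v i) := fun i hi => (Finset.mem_filter.1 hi).2
  choose! c hcB hc using hex
  refine Finset.card_le_card_of_injOn c hcB fun i hi j hj hij => ?_
  refine h.eq_of_mem i (Finset.mem_range.1 (Finset.mem_filter.1 hi).1) j
    (Finset.mem_range.1 (Finset.mem_filter.1 hj).1) (c i) (hc i hi) ?_
  rw [hij]
  exact hc j hj

/-- `φ` is constant on an interval of a cycle without breakpoints. -/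
theorem logSlope_eq (h : IsIntervalCycle f q u v) (hf : IsLogSlope f B φ) {i : ℕ} (hi : i < q)
    (hB : ¬ ∃ b ∈ B, b ∈ Set.Icc (u i) (v i)) {x : ℝ} (hx : x ∈ Set.Icc (u i) (v i)) :
    φ x = φ (v i) := by
  refine hf.const _ _ (h.sub i hi hx).1 hx.2 (h.sub i hi ⟨(h.lt i hi).le, le_rfl⟩).2
    fun b hb hxb => ?_
  by_contra hbv
  exact hB ⟨b, hb, hx.1.trans hxb.le, not_lt.1 hbv⟩

end IsIntervalCycle

namespace IsLogSlope

variable {f : ℝ → ℝ} {B : Finset ℝ} {φ : ℝ → ℝ}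

/-- The sums over the orbit segments through a cycle differ from the sums over the right
endpoints by finitely many values. -/
theorem exists_finite_sum_sub (hf : IsLogSlope f B φ) :
    ∃ D : Set ℝ, D.Finite ∧ ∀ (q : ℕ) (u v : ℕ → ℝ), IsIntervalCycle f q u v →
      ∀ x : ℕ → ℝ, (∀ i < q, x i ∈ Set.Icc (u i) (v i)) →
        ∑ i ∈ Finset.range q, φ (x i) - ∑ i ∈ Finset.range q, φ (v i) ∈ D := by
  classical
  obtain ⟨D, hD, h⟩ := exists_finite_sums
    (hf.finite_range.image2 (fun a b : ℝ => a - b) hf.finite_range) B.card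
  refine ⟨D, hD, fun q u v hc x hx => ?_⟩
  rw [← Finset.sum_sub_distrib, ← Finset.sum_filter_of_ne
    (p := fun i => ∃ b ∈ B, b ∈ Set.Icc (u i) (v i))]
  · exact h _ _ (hc.card_filter_le B) fun i _ => ⟨_, ⟨x i, rfl⟩, _, ⟨v i, rfl⟩, rfl⟩
  · intro i hi hne
    by_contra hB
    rw [Finset.mem_range] at hi
    exact hne (sub_eq_zero.2 (hc.logSlope_eq hf hi hB (hx i hi)))

/-- Expansion of some subinterval, with a uniform constant. -/
theorem exists_expansion (hf : IsLogSlope f B φ) :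
    ∃ K, 0 ≤ K ∧ ∀ u v : ℝ, 0 ≤ u → u < v → v ≤ 1 → ∀ z : ℝ,
      ∃ x y, u ≤ x ∧ x ≤ y ∧ y ≤ v ∧ Real.exp (φ z - K) * (v - u) ≤ |f y - f x| := by
  obtain ⟨C, hC0, hC⟩ := hf.exists_bound
  refine ⟨2 * C + B.card * Real.log 2, by positivity, fun u v hu huv hv z => ?_⟩
  obtain ⟨x, y, h1, h2, h3, h4, h5⟩ :=
    exists_subinterval_avoiding B B.card u v huv (Finset.card_filter_le _ _)
  refine ⟨x, y, h1, h2.le, h3, ?_⟩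
  rw [hf.abs_sub_eq (hu.trans h1) h2 (h3.trans hv) h4]
  have hz := abs_le.1 (hC z)
  have hx := abs_le.1 (hC x)
  have h6 : Real.exp (φ z - (2 * C + B.card * Real.log 2)) * 2 ^ B.card ≤ Real.exp (φ x) := by
    have : (2 : ℝ) ^ B.card = Real.exp (B.card * Real.log 2) := by
      rw [Real.exp_nat_mul, Real.exp_log two_pos]
    rw [this, ← Real.exp_add, Real.exp_le_exp]
    linarith
  calc _ ≤ Real.exp (φ z - (2 * C + B.card * Real.log 2)) * (2 ^ B.card * (y - x)) := by gcongr
    _ ≤ _ := by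
      rw [← mul_assoc]
      exact mul_le_mul_of_nonneg_right h6 (sub_nonneg.2 h2.le)

/-- The logarithmic slopes at the right endpoints of a cycle have uniformly bounded sum. -/
theorem exists_sum_le (hf : IsLogSlope f B φ) :
    ∃ C, ∀ (q : ℕ) (u v : ℕ → ℝ), IsIntervalCycle f q u v →
      ∑ i ∈ Finset.range q, φ (v i) ≤ C := by
  classical
  obtain ⟨K, hK, hexp⟩ := hf.exists_expansion
  refine ⟨B.card * K, fun q u v h => ?_⟩
  let ψ : ℕ → ℝ := fun i => φ (v i) - if ∃ b ∈ B, b ∈ Set.Icc (u i) (v i) then K else 0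
  have step : ∀ i < q, ∀ x y, x ∈ Set.Icc (u i) (v i) → y ∈ Set.Icc (u i) (v i) → x < y →
      ∃ x' ∈ Set.Icc (u ((i + 1) % q)) (v ((i + 1) % q)),
        ∃ y' ∈ Set.Icc (u ((i + 1) % q)) (v ((i + 1) % q)),
          Real.exp (ψ i) * (y - x) ≤ y' - x' := by
    intro i hi x y hx hy hxy
    obtain ⟨x', hx', y', hy', hle⟩ : ∃ x' ∈ Set.Icc (u i) (v i), ∃ y' ∈ Set.Icc (u i) (v i),
        Real.exp (ψ i) * (y - x) ≤ |f y' - f x'| := by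
      by_cases hB : ∃ b ∈ B, b ∈ Set.Icc (u i) (v i)
      · obtain ⟨x', y', h1, h2, h3, h4⟩ :=
          hexp x y (h.sub i hi hx).1 hxy (h.sub i hi hy).2 (v i)
        refine ⟨x', ⟨hx.1.trans h1, (h2.trans h3).trans hy.2⟩,
          y', ⟨(hx.1.trans h1).trans h2, h3.trans hy.2⟩, ?_⟩
        simpa only [ψ, if_pos hB] using h4
      · refine ⟨x, hx, y, hy, ?_⟩
        rw [hf.abs_sub_eq (h.sub i hi hx).1 hxy (h.sub i hi hy).2, h.logSlope_eq hf hi hB hx]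
        · simp only [ψ, if_neg hB, sub_zero, le_refl]
        · intro b hb hxb
          by_contra hyb
          exact hB ⟨b, hb, hx.1.trans hxb.le, (not_le.1 hyb).le.trans hy.2⟩
    have h1 := h.map i hi x' hx'
    have h2 := h.map i hi y' hy'
    rcases abs_cases (f y' - f x') with h3 | h3
    · exact ⟨_, h1, _, h2, hle.trans h3.1.le⟩
    · exact ⟨_, h2, _, h1, by linarith [hle, h3.1]⟩
  have growth : ∀ i ≤ q, ∃ x ∈ Set.Icc (u (i % q)) (v (i % q)),
      ∃ y ∈ Set.Icc (u (i % q)) (v (i % q)),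
        Real.exp (∑ j ∈ Finset.range i, ψ j) * (v 0 - u 0) ≤ y - x := by
    intro i
    induction i with
    | zero =>
      intro _
      have := (h.lt 0 h.pos).le
      exact ⟨u 0, by simpa using this, v 0, by simpa using this, by simp⟩
    | succ i ih =>
      intro hi
      obtain ⟨x, hx, y, hy, hxy⟩ := ih (by omega)
      rw [Nat.mod_eq_of_lt (by omega : i < q)] at hx hy
      have hpos : 0 < Real.exp (∑ j ∈ Finset.range i, ψ j) * (v 0 - u 0) :=
        mul_pos (Real.exp_pos _) (sub_pos.2 (h.lt 0 h.pos))
      obtain ⟨x', hx', y', hy', hle⟩ := step i (by omega) x y hx hy (by linarith)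
      refine ⟨x', hx', y', hy', le_trans ?_ hle⟩
      rw [Finset.sum_range_succ, add_comm, Real.exp_add, mul_assoc]
      exact mul_le_mul_of_nonneg_left hxy (Real.exp_pos _).le
  obtain ⟨x, hx, y, hy, hxy⟩ := growth q le_rfl
  rw [Nat.mod_self] at hx hy
  have h0 := sub_pos.2 (h.lt 0 h.pos)
  have h1 : Real.exp (∑ j ∈ Finset.range q, ψ j) ≤ 1 := by
    by_contra hcon
    have := mul_lt_mul_of_pos_right (not_le.1 hcon) h0
    linarith [hx.1, hy.2]
  have h2 := Real.exp_le_one_iff.1 h1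
  simp only [ψ, Finset.sum_sub_distrib, ← Finset.sum_filter, Finset.sum_const,
    nsmul_eq_mul] at h2
  have h3 : ((((Finset.range q).filter fun i => ∃ b ∈ B, b ∈ Set.Icc (u i) (v i)).card : ℕ) : ℝ)
      ≤ B.card := by exact_mod_cast h.card_filter_le B
  nlinarith

end IsLogSlope

/-- A cycle whose intervals `[α k, β k]`, `k < Q`, are numbered from left to right and permuted
according to `π`. -/
structure IsSortedCycle (f : ℝ → ℝ) (Q : ℕ) (α β : ℕ → ℝ) (π : ℕ → ℕ) : Prop where
  lt : ∀ k < Q, α k < β k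
  sep : ∀ k l, k < l → l < Q → β k < α l
  perm_lt : ∀ k < Q, π k < Q
  perm_inj : Set.InjOn π (Set.Iio Q)
  map : ∀ k < Q, ∀ x ∈ Set.Icc (α k) (β k), f x ∈ Set.Icc (α (π k)) (β (π k))
  le_period : ∀ x ∈ intervalUnion Q α β, ∀ t, 0 < t → f^[t] x = x → Q ≤ t

theorem IsIntervalCycle.exists_isSortedCycle {f : ℝ → ℝ} {Q : ℕ} {u v : ℕ → ℝ}
    (h : IsIntervalCycle f Q u v) :
    ∃ σ : Equiv.Perm ℕ, (∀ k, σ k < Q ↔ k < Q) ∧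
      intervalUnion Q (u ∘ σ) (v ∘ σ) = intervalUnion Q u v ∧
      ∃ π, IsSortedCycle f Q (u ∘ σ) (v ∘ σ) π := by
  obtain ⟨σ, hσ, hmono⟩ := exists_perm_monotoneOn Q u
  have hσ' : ∀ k, σ.symm k < Q ↔ k < Q := fun k => by
    rw [← hσ (σ.symm k), Equiv.apply_symm_apply]
  have hmod : ∀ j, (j + 1) % Q < Q := fun j => Nat.mod_lt _ h.pos
  have hunion : intervalUnion Q (u ∘ σ) (v ∘ σ) = intervalUnion Q u v := by
    ext x
    constructor
    · rintro ⟨k, hk, hx⟩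
      exact ⟨σ k, (hσ k).2 hk, hx⟩
    · rintro ⟨j, hj, hx⟩
      exact ⟨σ.symm j, (hσ' j).2 hj, by simpa using hx⟩
  refine ⟨σ, hσ, hunion, fun k => σ.symm ((σ k + 1) % Q), ?_, ?_, ?_, ?_, ?_, ?_⟩
  · exact fun k hk => h.lt _ ((hσ k).2 hk)
  · intro k l hkl hl
    have hk : k < Q := hkl.trans hl
    by_contra hcon
    have h1 : u (σ k) ≤ u (σ l) := hmono hk hl hkl.le
    have h2 := h.eq_of_mem _ ((hσ k).2 hk) _ ((hσ l).2 hl) (u (σ l)) ⟨h1, not_lt.1 hcon⟩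
      ⟨le_rfl, (h.lt _ ((hσ l).2 hl)).le⟩
    exact hkl.ne (σ.injective h2)
  · exact fun k _ => (hσ' _).2 (hmod _)
  · intro k hk l hl hkl
    have h1 : (σ k + 1) % Q = (σ l + 1) % Q := σ.symm.injective hkl
    have h2 : σ k ≡ σ l [MOD Q] := Nat.ModEq.add_right_cancel' 1 h1
    have h3 := (hσ k).2 hk
    have h4 := (hσ l).2 hl
    rw [Nat.ModEq, Nat.mod_eq_of_lt h3, Nat.mod_eq_of_lt h4] at h2
    exact σ.injective h2
  · intro k hk x hx
    simpa using h.map _ ((hσ k).2 hk) x hx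
  · intro x hx t ht hfx
    rw [hunion] at hx
    exact h.le_of_iterate_eq hx ht hfx

namespace IsSortedCycle

variable {f : ℝ → ℝ} {Q : ℕ} {α β : ℕ → ℝ} {π : ℕ → ℕ}

theorem left_mono (h : IsSortedCycle f Q α β π) {k l : ℕ} (hkl : k ≤ l) (hl : l < Q) :
    α k ≤ α l := by
  rcases hkl.eq_or_lt with rfl | hlt
  · exact le_rfl
  · exact ((h.lt k (hlt.trans hl)).trans (h.sep k l hlt hl)).le

theorem right_mono (h : IsSortedCycle f Q α β π) {k l : ℕ} (hkl : k ≤ l) (hl : l < Q) :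
    β k ≤ β l := by
  rcases hkl.eq_or_lt with rfl | hlt
  · exact le_rfl
  · exact ((h.sep k l hlt hl).trans (h.lt l hl)).le

theorem left_mem (h : IsSortedCycle f Q α β π) {k : ℕ} (hk : k < Q) :
    α k ∈ Set.Icc (α k) (β k) := ⟨le_rfl, (h.lt k hk).le⟩

theorem right_mem (h : IsSortedCycle f Q α β π) {k : ℕ} (hk : k < Q) :
    β k ∈ Set.Icc (α k) (β k) := ⟨(h.lt k hk).le, le_rfl⟩

theorem map_mem_union (h : IsSortedCycle f Q α β π) {x : ℝ} (hx : x ∈ intervalUnion Q α β) :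
    f x ∈ intervalUnion Q α β := by
  obtain ⟨k, hk, hxk⟩ := hx
  exact ⟨_, h.perm_lt k hk, h.map k hk x hxk⟩

theorem notMem_union_of_gap (h : IsSortedCycle f Q α β π) {k : ℕ} (hk : k + 1 < Q) {x : ℝ}
    (hx : x ∈ Set.Ioo (β k) (α (k + 1))) : x ∉ intervalUnion Q α β := by
  rintro ⟨l, hl, hxl⟩
  rcases Nat.lt_or_ge k l with hkl | hkl
  · linarith [h.left_mono (show k + 1 ≤ l from hkl) hl, hxl.1, hx.2]
  · linarith [h.right_mono hkl (by omega), hxl.2, hx.1]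

/-- The image of a gap covers all gaps between the images of its neighbours. -/
theorem gap_span_le (h : IsSortedCycle f Q α β π) {k l l' : ℕ} (hk : k + 1 < Q) (hl : l < Q)
    (hmin : min (π k) (π (k + 1)) ≤ l) (hmax : l' < max (π k) (π (k + 1))) :
    α (l' + 1) - β l ≤ |f (α (k + 1)) - f (β k)| := by
  have h1 := h.map k (by omega) _ (h.right_mem (by omega))
  have h2 := h.map (k + 1) hk _ (h.left_mem hk)
  have h3 := h.perm_lt k (by omega)
  have h4 := h.perm_lt (k + 1) hk
  rcases le_total (π k) (π (k + 1)) with hle | hle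
  · rw [min_eq_left hle] at hmin
    rw [max_eq_right hle] at hmax
    linarith [h.right_mono hmin hl, h.left_mono (show l' + 1 ≤ _ from hmax) h4, h1.2, h2.1,
      le_abs_self (f (α (k + 1)) - f (β k))]
  · rw [min_eq_right hle] at hmin
    rw [max_eq_left hle] at hmax
    linarith [h.right_mono hmin hl, h.left_mono (show l' + 1 ≤ _ from hmax) h3, h1.1, h2.2,
      neg_le_abs (f (α (k + 1)) - f (β k))]

end IsSortedCycle

/-- The sorted cycle `[α k, β k]`, `k < Q`, refines the cycle `[u i, v i]`, `i < q`, with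
`[α k, β k]` contained in `[u (b k), v (b k)]`, and contains all breakpoints of the latter. -/
structure IsRefinement (f : ℝ → ℝ) (B : Finset ℝ) (φ : ℝ → ℝ) (q : ℕ) (u v : ℕ → ℝ) (Q : ℕ)
    (α β : ℕ → ℝ) (π b : ℕ → ℕ) : Prop where
  logSlope : IsLogSlope f B φ
  outer : IsIntervalCycle f q u v
  sorted : IsSortedCycle f Q α β π
  lt : q < Q
  block_lt : ∀ k < Q, b k < q
  block_sub : ∀ k < Q, Set.Icc (α k) (β k) ⊆ Set.Icc (u (b k)) (v (b k))
  block_surj : ∀ i < q, ∃ k < Q, b k = i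
  breakpoint : ∀ c ∈ B, c ∈ intervalUnion q u v → c ∈ intervalUnion Q α β

/-- The gaps of a refinement between neighbours in the same block, indexed by the left
neighbour. -/
def innerGaps (Q : ℕ) (b : ℕ → ℕ) : Finset ℕ :=
  (Finset.range Q).filter fun k => k + 1 < Q ∧ b k = b (k + 1)

theorem mem_innerGaps {Q : ℕ} {b : ℕ → ℕ} {k : ℕ} :
    k ∈ innerGaps Q b ↔ k + 1 < Q ∧ b k = b (k + 1) := by
  simp only [innerGaps, Finset.mem_filter, Finset.mem_range]
  exact ⟨fun h => h.2, fun h => ⟨by omega, h⟩⟩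

namespace IsRefinement

variable {f : ℝ → ℝ} {B : Finset ℝ} {φ : ℝ → ℝ} {q : ℕ} {u v : ℕ → ℝ} {Q : ℕ}
  {α β : ℕ → ℝ} {π b : ℕ → ℕ}

theorem block_eq (h : IsRefinement f B φ q u v Q α β π b) {k i : ℕ} (hk : k < Q) (hi : i < q)
    {x : ℝ} (hx : x ∈ Set.Icc (α k) (β k)) (hxi : x ∈ Set.Icc (u i) (v i)) : b k = i :=
  h.outer.eq_of_mem _ (h.block_lt k hk) _ hi x (h.block_sub k hk hx) hxi

theorem block_map (h : IsRefinement f B φ q u v Q α β π b) {k : ℕ} (hk : k < Q) :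
    b (π k) = (b k + 1) % q := by
  have h1 := h.sorted.left_mem hk
  exact h.block_eq (h.sorted.perm_lt k hk) (Nat.mod_lt _ h.outer.pos) (h.sorted.map k hk _ h1)
    (h.outer.map _ (h.block_lt k hk) _ (h.block_sub k hk h1))

/-- Blocks are convex. -/
theorem block_eq_of_between (h : IsRefinement f B φ q u v Q α β π b) {k l m : ℕ} (hkl : k ≤ l)
    (hlm : l ≤ m) (hm : m < Q) (hb : b k = b m) : b l = b k := by
  have hk : k < Q := by omega
  have hl : l < Q := by omega
  rcases hkl.eq_or_lt with rfl | hkl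
  · rfl
  refine h.block_eq hl (h.block_lt k hk) (h.sorted.left_mem hl)
    ⟨(h.block_sub k hk (h.sorted.left_mem hk)).1.trans (h.sorted.left_mono hkl.le hl), ?_⟩
  rw [hb]
  exact (h.sorted.left_mono hlm hm).trans (h.block_sub m hm (h.sorted.left_mem hm)).2

theorem gap_pos (h : IsRefinement f B φ q u v Q α β π b) {k : ℕ} (hk : k ∈ innerGaps Q b) :
    0 < α (k + 1) - β k :=
  sub_pos.2 (h.sorted.sep _ _ (Nat.lt_succ_self k) (mem_innerGaps.1 hk).1)

theorem gap_subset (h : IsRefinement f B φ q u v Q α β π b) {k : ℕ} (hk : k ∈ innerGaps Q b) :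
    Set.Icc (β k) (α (k + 1)) ⊆ Set.Icc (u (b k)) (v (b k)) := by
  obtain ⟨hk1, hkb⟩ := mem_innerGaps.1 hk
  have hk0 : k < Q := by omega
  refine Set.Icc_subset_Icc (h.block_sub k hk0 (h.sorted.right_mem hk0)).1 ?_
  rw [hkb]
  exact (h.block_sub _ hk1 (h.sorted.left_mem hk1)).2

theorem gap_breakpoint (h : IsRefinement f B φ q u v Q α β π b) {k : ℕ}
    (hk : k ∈ innerGaps Q b) : ∀ c ∈ B, β k < c → α (k + 1) ≤ c := by
  intro c hc h1
  by_contra h2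
  have h3 : c ∈ Set.Ioo (β k) (α (k + 1)) := ⟨h1, not_le.1 h2⟩
  refine h.sorted.notMem_union_of_gap (mem_innerGaps.1 hk).1 h3 (h.breakpoint c hc ?_)
  exact ⟨_, h.block_lt k (by have := (mem_innerGaps.1 hk).1; omega),
    h.gap_subset hk (Set.Ioo_subset_Icc_self h3)⟩

theorem gap_subset_unit (h : IsRefinement f B φ q u v Q α β π b) {k : ℕ}
    (hk : k ∈ innerGaps Q b) : Set.Icc (β k) (α (k + 1)) ⊆ Set.Icc 0 1 :=
  (h.gap_subset hk).trans
    (h.outer.sub _ (h.block_lt k (by have := (mem_innerGaps.1 hk).1; omega)))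

theorem abs_gap_image (h : IsRefinement f B φ q u v Q α β π b) {k : ℕ}
    (hk : k ∈ innerGaps Q b) :
    |f (α (k + 1)) - f (β k)| = Real.exp (φ (β k)) * (α (k + 1) - β k) := by
  have hlt := sub_pos.1 (h.gap_pos hk)
  exact h.logSlope.abs_sub_eq (h.gap_subset_unit hk ⟨le_rfl, hlt.le⟩).1 hlt
    (h.gap_subset_unit hk ⟨hlt.le, le_rfl⟩).2 (h.gap_breakpoint hk)

theorem logSlope_gap (h : IsRefinement f B φ q u v Q α β π b) {k : ℕ} (hk : k ∈ innerGaps Q b)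
    {x : ℝ} (hx : x ∈ Set.Ioo (β k) (α (k + 1))) : φ x = φ (β k) := by
  have hlt := sub_pos.1 (h.gap_pos hk)
  exact (h.logSlope.const _ _ (h.gap_subset_unit hk ⟨le_rfl, hlt.le⟩).1 hx.1.le
    (h.gap_subset_unit hk (Set.Ioo_subset_Icc_self hx)).2
    fun c hc h1 => hx.2.trans_le (h.gap_breakpoint hk c hc h1)).symm

theorem sum_right_endpoints (h : IsRefinement f B φ q u v Q α β π b) :
    ∑ k ∈ Finset.range Q, φ (β k) =
      ∑ i ∈ Finset.range q, φ (v i) + ∑ k ∈ innerGaps Q b, φ (β k) := by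
  rw [innerGaps, ← Finset.sum_filter_add_sum_filter_not (Finset.range Q)
    (fun k => k + 1 < Q ∧ b k = b (k + 1)), add_comm, add_left_inj]
  have hlast : ∀ k l, k < l → l < Q → b k = b l → k + 1 < Q ∧ b k = b (k + 1) :=
    fun k l hkl hl hb => ⟨by omega, (h.block_eq_of_between (Nat.le_succ k) hkl hl hb).symm⟩
  refine Finset.sum_nbij b ?_ ?_ ?_ ?_
  · intro k hk
    simp only [Finset.mem_filter, Finset.mem_range] at hk ⊢
    exact h.block_lt k hk.1
  · intro k hk l hl hkl
    simp only [Finset.coe_filter, Finset.mem_range, Set.mem_ofPred_eq] at hk hl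
    rcases lt_trichotomy k l with hlt | heq | hlt
    · exact absurd (hlast k l hlt hl.1 hkl) hk.2
    · exact heq
    · exact absurd (hlast l k hlt hk.1 hkl.symm) hl.2
  · intro i hi
    obtain ⟨k, hk, hki⟩ := h.block_surj i (by simpa using hi)
    obtain ⟨m, hm, hmax⟩ := Finset.exists_max_image ((Finset.range Q).filter fun k => b k = i) id
      ⟨k, by simp [hk, hki]⟩
    simp only [Finset.mem_filter, Finset.mem_range, id] at hm hmax
    refine ⟨m, ?_, hm.2⟩
    simp only [Finset.coe_filter, Finset.mem_range, Set.mem_ofPred_eq]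
    refine ⟨hm.1, fun hcon => ?_⟩
    have := hmax (m + 1) ⟨hcon.1, hcon.2 ▸ hm.2⟩
    omega
  · intro k hk
    simp only [Finset.mem_filter, Finset.mem_range] at hk
    have h1 := h.block_sub k hk.1 (h.sorted.right_mem hk.1)
    have h2 := h.block_lt k hk.1
    have h3 : v (b k) ∈ Set.Icc (u (b k)) (v (b k)) := ⟨(h.outer.lt _ h2).le, le_rfl⟩
    refine h.logSlope.const _ _ (h.outer.sub _ h2 h1).1 h1.2 (h.outer.sub _ h2 h3).2
      fun c hc hkc => ?_
    by_contra hcv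
    have hcI : c ∈ Set.Icc (u (b k)) (v (b k)) := ⟨h1.1.trans hkc.le, not_lt.1 hcv⟩
    obtain ⟨l, hl, hcl⟩ := h.breakpoint c hc ⟨_, h2, hcI⟩
    refine hk.2 (hlast k l ?_ hl (h.block_eq hl h2 hcl hcI).symm)
    by_contra hle
    linarith [h.sorted.right_mono (not_lt.1 hle) hk.1, hcl.2]

/-- The gaps of a refinement can be permuted in such a way that the image of each gap covers the
gap assigned to it. -/
theorem exists_gap_perm (h : IsRefinement f B φ q u v Q α β π b) :
    ∃ τ : ℕ → ℕ, Set.InjOn τ (innerGaps Q b) ∧ ∀ k ∈ innerGaps Q b, τ k ∈ innerGaps Q b ∧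
      min (π k) (π (k + 1)) ≤ τ k ∧ τ k < max (π k) (π (k + 1)) := by
  obtain ⟨τ, hinj, hτ⟩ := exists_injOn_between (Q - 1) π fun a ha b hb hab =>
    h.sorted.perm_inj (by have := h.lt; simp at ha ⊢; omega)
      (by have := h.lt; simp at hb ⊢; omega) hab
  refine ⟨τ, hinj.mono fun k hk => ?_, fun k hk => ?_⟩
  · have := (mem_innerGaps.1 hk).1
    simp only [Set.mem_Iio]
    omega
  · obtain ⟨hk1, hkb⟩ := mem_innerGaps.1 hk
    obtain ⟨_, hmin, hmax⟩ := hτ k (by omega)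
    refine ⟨?_, hmin, hmax⟩
    have h1 := h.block_map (show k < Q by omega)
    have h2 := h.block_map hk1
    have h3 := h.sorted.perm_lt k (by omega)
    have h4 := h.sorted.perm_lt (k + 1) hk1
    have h5 : b (π k) = b (π (k + 1)) := by rw [h1, h2, hkb]
    rw [mem_innerGaps]
    rcases le_total (π k) (π (k + 1)) with hle | hle
    · rw [min_eq_left hle] at hmin
      rw [max_eq_right hle] at hmax
      refine ⟨by omega, ?_⟩
      rw [h.block_eq_of_between hmin hmax.le h4 h5,
        h.block_eq_of_between (hmin.trans (Nat.le_succ _)) hmax h4 h5]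
    · rw [min_eq_right hle] at hmin
      rw [max_eq_left hle] at hmax
      refine ⟨by omega, ?_⟩
      rw [h.block_eq_of_between hmin hmax.le h3 h5.symm,
        h.block_eq_of_between (hmin.trans (Nat.le_succ _)) hmax h3 h5.symm]

/-- If a gap contains a point mapped into another gap, then its image covers that gap. -/
theorem covers_of_mem (h : IsRefinement f B φ q u v Q α β π b) {k l : ℕ}
    (hk : k ∈ innerGaps Q b) (hl : l + 1 < Q) {x : ℝ} (hx : x ∈ Set.Ioo (β k) (α (k + 1)))
    (hfx : f x ∈ Set.Ioo (β l) (α (l + 1))) :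
    min (π k) (π (k + 1)) ≤ l ∧ l < max (π k) (π (k + 1)) := by
  have hk1 := (mem_innerGaps.1 hk).1
  have hlt := sub_pos.1 (h.gap_pos hk)
  obtain ⟨s, -, hs⟩ := h.logSlope.affine (β k) (α (k + 1))
    (h.gap_subset_unit hk ⟨le_rfl, hlt.le⟩).1 hlt
    (h.gap_subset_unit hk ⟨hlt.le, le_rfl⟩).2 (h.gap_breakpoint hk)
  have e1 := hs x (Set.Ioo_subset_Icc_self hx)
  have e2 := hs (α (k + 1)) ⟨hlt.le, le_rfl⟩
  have h1 := h.sorted.map k (by omega) _ (h.sorted.right_mem (by omega))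
  have h2 := h.sorted.map (k + 1) hk1 _ (h.sorted.left_mem hk1)
  have h3 := h.sorted.perm_lt k (by omega)
  have h4 := h.sorted.perm_lt (k + 1) hk1
  constructor
  · by_contra hcon
    rw [not_le, lt_min_iff] at hcon
    have h5 := h.sorted.left_mono (show l + 1 ≤ _ from hcon.1) h3
    have h6 := h.sorted.left_mono (show l + 1 ≤ _ from hcon.2) h4
    rcases le_total 0 s with h0 | h0
    · nlinarith [hx.1, hx.2, hfx.2, h1.1, h2.1]
    · nlinarith [hx.1, hx.2, hfx.2, h1.1, h2.1]
  · by_contra hcon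
    rw [not_lt, max_le_iff] at hcon
    have h5 := h.sorted.right_mono hcon.1 (by omega)
    have h6 := h.sorted.right_mono hcon.2 (by omega)
    rcases le_total 0 s with h0 | h0
    · nlinarith [hx.1, hx.2, hfx.1, h1.2, h2.2]
    · nlinarith [hx.1, hx.2, hfx.1, h1.2, h2.2]

end IsRefinement

namespace IsRefinement

variable {f : ℝ → ℝ} {B : Finset ℝ} {φ : ℝ → ℝ} {q : ℕ} {u v : ℕ → ℝ} {Q : ℕ}
  {α β : ℕ → ℝ} {π b : ℕ → ℕ}

/-- A point outside the refinement which lies between two of its points in a common block belongs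
to an inner gap. -/
theorem exists_mem_gap (h : IsRefinement f B φ q u v Q α β π b) {i : ℕ} (hi : i < q)
    {x L R : ℝ} (hx : x ∉ intervalUnion Q α β) (hL : L ∈ intervalUnion Q α β)
    (hR : R ∈ intervalUnion Q α β) (hLi : L ∈ Set.Icc (u i) (v i))
    (hRi : R ∈ Set.Icc (u i) (v i)) (hLx : L ≤ x) (hxR : x ≤ R) :
    ∃ k ∈ innerGaps Q b, b k = i ∧ x ∈ Set.Ioo (β k) (α (k + 1)) := by
  obtain ⟨k₁, hk₁, hL₁⟩ := hL
  obtain ⟨k₂, hk₂, hR₂⟩ := hR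
  set k := Nat.findGreatest (fun k => α k ≤ x) (Q - 1) with hk
  have hkQ : k ≤ Q - 1 := Nat.findGreatest_le _
  have hk₁k : k₁ ≤ k := Nat.le_findGreatest (by omega) (hL₁.1.trans hLx)
  have hkx : α k ≤ x :=
    Nat.findGreatest_spec (P := fun k => α k ≤ x) (show k₁ ≤ Q - 1 by omega) (hL₁.1.trans hLx)
  have hβx : β k < x := by
    by_contra hcon
    exact hx ⟨k, by omega, hkx, not_lt.1 hcon⟩
  have hkk₂ : k < k₂ := by
    by_contra hcon
    have := h.sorted.right_mono (not_lt.1 hcon) (by omega)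
    linarith [hR₂.2]
  have hxα : x < α (k + 1) := not_le.1
    (Nat.findGreatest_is_greatest (P := fun k => α k ≤ x) (n := Q - 1) (k := k + 1)
      (Nat.lt_succ_self _) (by omega))
  have hb₁ : b k₁ = i := h.block_eq hk₁ hi hL₁ hLi
  have hb₂ : b k₂ = i := h.block_eq hk₂ hi hR₂ hRi
  have hb : b k₁ = b k₂ := hb₁.trans hb₂.symm
  have hbk : b k = i := (h.block_eq_of_between hk₁k hkk₂.le hk₂ hb).trans hb₁
  have hbk' : b (k + 1) = i := (h.block_eq_of_between (by omega) hkk₂ hk₂ hb).trans hb₁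
  exact ⟨k, mem_innerGaps.2 ⟨by omega, hbk.trans hbk'.symm⟩, hbk, hβx, hxα⟩

/-- There is a periodic orbit of period `q` visiting inner gaps only. -/
theorem exists_periodic (h : IsRefinement f B φ q u v Q α β π b) :
    ∃ p, f^[q] p = p ∧ ∀ i < q, ∃ k ∈ innerGaps Q b, b k = i ∧
      f^[i] p ∈ Set.Ioo (β k) (α (k + 1)) := by
  have hne : ∀ i < q, (intervalUnion Q α β ∩ Set.Icc (u i) (v i)).Nonempty := by
    intro i hi
    obtain ⟨k, hk, rfl⟩ := h.block_surj i hi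
    exact ⟨α k, ⟨k, hk, h.sorted.left_mem hk⟩, h.block_sub k hk (h.sorted.left_mem hk)⟩
  have hcpt : ∀ i, IsCompact (intervalUnion Q α β ∩ Set.Icc (u i) (v i)) := fun i =>
    (isCompact_intervalUnion Q α β).inter_right isClosed_Icc
  have hleast := fun i hi => (hcpt i).exists_isLeast (hne i hi)
  have hgreatest := fun i hi => (hcpt i).exists_isGreatest (hne i hi)
  choose! L hL using hleast
  choose! R hR using hgreatest
  have hmod : ∀ i, i % q < q := fun i => Nat.mod_lt _ h.outer.pos
  have hLR : ∀ i < q, L i ≤ R i := fun i hi => (hL i hi).2 (hR i hi).1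
  have hsub : ∀ i < q, Set.Icc (L i) (R i) ⊆ Set.Icc (u i) (v i) := fun i hi =>
    Set.Icc_subset_Icc (hL i hi).1.2.1 (hR i hi).1.2.2
  let X : ℕ → ℝ → ℝ := fun i x =>
    Nat.rec x (fun i y => max (L ((i + 1) % q)) (min (R ((i + 1) % q)) (f y))) i
  have hX0 : ∀ x, X 0 x = x := fun _ => rfl
  have hXs : ∀ i x, X (i + 1) x = max (L ((i + 1) % q)) (min (R ((i + 1) % q)) (f (X i x))) :=
    fun _ _ => rfl
  have hXm : ∀ i, Set.MapsTo (X i) (Set.Icc (L 0) (R 0)) (Set.Icc (L (i % q)) (R (i % q))) := by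
    intro i x hx
    cases i with
    | zero => rwa [hX0, Nat.zero_mod]
    | succ i =>
      rw [hXs]
      exact ⟨le_max_left _ _, max_le (hLR _ (hmod _)) (min_le_left _ _)⟩
  have hXc : ∀ i, ContinuousOn (X i) (Set.Icc (L 0) (R 0)) := by
    intro i
    induction i with
    | zero => exact continuousOn_id
    | succ i ih =>
      refine continuousOn_const.sup (continuousOn_const.inf (h.logSlope.cont.comp ih ?_))
      exact (hXm i).mono_right ((hsub _ (hmod i)).trans (h.outer.sub _ (hmod i)))
  clear_value X
  obtain ⟨p, hp, hfix⟩ := exists_mem_Icc_isFixedPt_of_mapsTo (hXc q) (hLR 0 h.outer.pos)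
    (by simpa using hXm q)
  have hblock : ∀ i, X i p ∈ Set.Icc (u (i % q)) (v (i % q)) := fun i =>
    hsub _ (hmod i) (hXm i hp)
  have hfblock : ∀ i, f (X i p) ∈ Set.Icc (u ((i + 1) % q)) (v ((i + 1) % q)) := fun i => by
    simpa using h.outer.map _ (hmod i) _ (hblock i)
  have hstep : ∀ i, X i p ∈ intervalUnion Q α β →
      X (i + 1) p = f (X i p) ∧ X (i + 1) p ∈ intervalUnion Q α β := by
    intro i hi
    have h1 := h.sorted.map_mem_union hi
    have h2 := (hL _ (hmod (i + 1))).2 ⟨h1, hfblock i⟩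
    have h3 := (hR _ (hmod (i + 1))).2 ⟨h1, hfblock i⟩
    have h4 : X (i + 1) p = f (X i p) := by rw [hXs, min_eq_right h3, max_eq_right h2]
    exact ⟨h4, h4 ▸ h1⟩
  have hpU : p ∉ intervalUnion Q α β := by
    intro hpU
    have : ∀ i, X i p = f^[i] p ∧ X i p ∈ intervalUnion Q α β := by
      intro i
      induction i with
      | zero => exact ⟨hX0 p, (hX0 p).symm ▸ hpU⟩
      | succ i ih =>
        rw [Function.iterate_succ_apply', ← ih.1]
        exact hstep i ih.2
    have h1 := h.sorted.le_period p hpU q h.outer.pos ((this q).1.symm.trans hfix)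
    exact absurd h.lt (not_lt.2 h1)
  have hXU : ∀ i ≤ q, X i p ∉ intervalUnion Q α β := by
    intro i hi hmem
    have : ∀ t, X (i + t) p ∈ intervalUnion Q α β := by
      intro t
      induction t with
      | zero => exact hmem
      | succ t ih => exact (hstep _ ih).2
    have h1 := this (q - i)
    rw [Nat.add_sub_cancel' hi, hfix.eq] at h1
    exact hpU h1
  have horbit : ∀ i ≤ q, X i p = f^[i] p := by
    intro i
    induction i with
    | zero => exact fun _ => hX0 p
    | succ i ih =>
      intro hi
      have h1 := hXU (i + 1) hi
      rw [Function.iterate_succ_apply', ← ih (by omega)]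
      rw [hXs] at h1 ⊢
      rcases le_total (f (X i p)) (R ((i + 1) % q)) with h2 | h2
      · rw [min_eq_right h2] at h1 ⊢
        rcases le_total (L ((i + 1) % q)) (f (X i p)) with h3 | h3
        · exact max_eq_right h3
        · rw [max_eq_left h3] at h1
          exact absurd (hL _ (hmod _)).1.1 h1
      · rw [min_eq_left h2, max_eq_right (hLR _ (hmod _))] at h1
        exact absurd (hR _ (hmod _)).1.1 h1
  refine ⟨p, (horbit q le_rfl).symm.trans hfix, fun i hi => ?_⟩
  have h1 := hXm i hp
  rw [Nat.mod_eq_of_lt hi] at h1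
  rw [← horbit i hi.le]
  exact h.exists_mem_gap hi (hXU i hi.le) (hL i hi).1.1 (hR i hi).1.1 (hL i hi).1.2 (hR i hi).1.2
    h1.1 h1.2

/-- The sums of logarithmic slopes over an orbit visiting inner gaps and over all inner gaps. -/
theorem sum_periodic (h : IsRefinement f B φ q u v Q α β π b) {p : ℝ} (hp : f^[q] p = p)
    (horbit : ∀ i < q, ∃ k ∈ innerGaps Q b, b k = i ∧ f^[i] p ∈ Set.Ioo (β k) (α (k + 1))) :
    0 ≤ ∑ i ∈ Finset.range q, φ (f^[i] p) ∧ 0 ≤ ∑ k ∈ innerGaps Q b, φ (β k) ∧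
      (∑ i ∈ Finset.range q, φ (f^[i] p) ≤ ∑ k ∈ innerGaps Q b, φ (β k) ∨
        Real.exp (-∑ i ∈ Finset.range q, φ (f^[i] p)) +
          Real.exp (-∑ k ∈ innerGaps Q b, φ (β k)) ≤ 1) := by
  obtain ⟨τ, hinj, hτ⟩ := h.exists_gap_perm
  choose! κ₀ hκ₀ using horbit
  obtain ⟨κ, hκ⟩ : ∃ κ : ℕ → ℕ, ∀ i, κ i = κ₀ (i % q) := ⟨fun i => κ₀ (i % q), fun _ => rfl⟩
  have hmod : ∀ i, i % q < q := fun i => Nat.mod_lt _ h.outer.pos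
  have hκG : ∀ i, κ i ∈ innerGaps Q b := fun i => hκ i ▸ (hκ₀ _ (hmod i)).1
  have hκb : ∀ i < q, b (κ i) = i := fun i hi => by
    rw [hκ, (hκ₀ _ (hmod i)).2.1, Nat.mod_eq_of_lt hi]
  have hκx : ∀ i, f^[i] p ∈ Set.Ioo (β (κ i)) (α (κ i + 1)) := fun i => by
    rw [hκ, ← Function.IsPeriodicPt.iterate_mod_apply (show Function.IsPeriodicPt f q p from hp) i]
    exact (hκ₀ _ (hmod i)).2.2
  obtain ⟨ℓ, hℓ⟩ : ∃ ℓ : ℕ → ℝ, ∀ k, ℓ k = α (k + 1) - β k := ⟨_, fun _ => rfl⟩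
  have hℓpos : ∀ k ∈ innerGaps Q b, 0 < ℓ k := fun k hk => hℓ k ▸ h.gap_pos hk
  obtain ⟨e, he⟩ : ∃ e : ℕ → ℕ → ℝ, ∀ k l,
      e k l = φ (β k) + Real.log (ℓ k) - Real.log (ℓ l) := ⟨_, fun _ _ => rfl⟩
  have hexp : ∀ k ∈ innerGaps Q b, ∀ l ∈ innerGaps Q b,
      Real.exp (-e k l) * (Real.exp (φ (β k)) * ℓ k) = ℓ l := by
    intro k hk l hl
    calc Real.exp (-e k l) * (Real.exp (φ (β k)) * ℓ k)
        = Real.exp (-e k l) * (Real.exp (φ (β k)) * Real.exp (Real.log (ℓ k))) := by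
          rw [Real.exp_log (hℓpos k hk)]
      _ = Real.exp (Real.log (ℓ l)) := by
          rw [← Real.exp_add, ← Real.exp_add, he]
          congr 1
          ring
      _ = ℓ l := Real.exp_log (hℓpos l hl)
  have hepos : ∀ k ∈ innerGaps Q b, ∀ l ∈ innerGaps Q b, min (π k) (π (k + 1)) ≤ l →
      l < max (π k) (π (k + 1)) → 0 ≤ e k l := by
    intro k hk l hl hmin hmax
    have h1 := h.sorted.gap_span_le (mem_innerGaps.1 hk).1
      (by have := (mem_innerGaps.1 hl).1; omega) hmin hmax
    rw [h.abs_gap_image hk, ← hℓ, ← hℓ, ← hexp k hk l hl] at h1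
    have h2 : 0 < Real.exp (φ (β k)) * ℓ k := mul_pos (Real.exp_pos _) (hℓpos k hk)
    have h3 : Real.exp (-e k l) ≤ 1 := by
      by_contra hcon
      nlinarith
    linarith [Real.exp_le_one_iff.1 h3]
  have hcov : ∀ i, min (π (κ i)) (π (κ i + 1)) ≤ κ (i + 1) ∧
      κ (i + 1) < max (π (κ i)) (π (κ i + 1)) := fun i =>
    h.covers_of_mem (hκG i) (mem_innerGaps.1 (hκG (i + 1))).1 (hκx i)
      (Function.iterate_succ_apply' f i p ▸ hκx (i + 1))
  have hm : ∑ i ∈ Finset.range q, φ (f^[i] p) =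
      ∑ i ∈ Finset.range q, e (κ i) (κ (i + 1)) := by
    have h1 : ∑ i ∈ Finset.range q, (Real.log (ℓ (κ (i + 1))) - Real.log (ℓ (κ i))) = 0 := by
      rw [Finset.sum_range_sub (fun i => Real.log (ℓ (κ i)))]
      simp [hκ]
    rw [← add_zero (∑ i ∈ Finset.range q, e (κ i) (κ (i + 1))), ← h1, ← Finset.sum_add_distrib]
    refine Finset.sum_congr rfl fun i _ => ?_
    rw [h.logSlope_gap (hκG i) (hκx i), he]
    ring
  have hM : ∑ k ∈ innerGaps Q b, φ (β k) = ∑ k ∈ innerGaps Q b, e k (τ k) := by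
    have himage : (innerGaps Q b).image τ = innerGaps Q b :=
      Finset.eq_of_subset_of_card_le
        (Finset.image_subset_iff.2 fun k hk => (hτ k hk).1)
        (Finset.card_image_of_injOn hinj).ge
    have h1 : ∑ k ∈ innerGaps Q b, Real.log (ℓ (τ k)) = ∑ k ∈ innerGaps Q b, Real.log (ℓ k) := by
      conv_rhs => rw [← himage]
      rw [Finset.sum_image hinj]
    simp only [he, Finset.sum_sub_distrib, Finset.sum_add_distrib, h1, add_sub_cancel_right]
  have hmpos : ∀ i ∈ Finset.range q, 0 ≤ e (κ i) (κ (i + 1)) := fun i _ =>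
    hepos _ (hκG i) _ (hκG (i + 1)) (hcov i).1 (hcov i).2
  have hMpos : ∀ k ∈ innerGaps Q b, 0 ≤ e k (τ k) := fun k hk =>
    hepos k hk _ (hτ k hk).1 (hτ k hk).2.1 (hτ k hk).2.2
  rw [hm, hM]
  refine ⟨Finset.sum_nonneg hmpos, Finset.sum_nonneg hMpos, ?_⟩
  by_cases hall : ∀ i < q, τ (κ i) = κ (i + 1)
  · left
    have hκinj : Set.InjOn κ (Finset.range q) := fun i hi j hj hij => by
      rw [← hκb i (by simpa using hi), ← hκb j (by simpa using hj), hij]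
    calc ∑ i ∈ Finset.range q, e (κ i) (κ (i + 1))
        = ∑ i ∈ Finset.range q, e (κ i) (τ (κ i)) :=
          Finset.sum_congr rfl fun i hi => by rw [hall i (Finset.mem_range.1 hi)]
      _ = ∑ k ∈ (Finset.range q).image κ, e k (τ k) :=
          (Finset.sum_image (f := fun k => e k (τ k)) hκinj).symm
      _ ≤ ∑ k ∈ innerGaps Q b, e k (τ k) :=
          Finset.sum_le_sum_of_subset_of_nonneg (Finset.image_subset_iff.2 fun i _ => hκG i)
            fun k hk _ => hMpos k hk
  · right
    push Not at hall
    obtain ⟨i, hi, hne⟩ := hall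
    have h1 := Finset.single_le_sum hmpos (Finset.mem_range.2 hi)
    have h2 := Finset.single_le_sum hMpos (hκG i)
    have hk := hκG i
    have hl := hκG (i + 1)
    obtain ⟨hl', hmin', hmax'⟩ := hτ _ hk
    obtain ⟨hmin, hmax⟩ := hcov i
    have hQ : ∀ k ∈ innerGaps Q b, k + 1 < Q := fun k hk => (mem_innerGaps.1 hk).1
    have hspan : ℓ (κ (i + 1)) + ℓ (τ (κ i)) ≤ Real.exp (φ (β (κ i))) * ℓ (κ i) := by
      rw [hℓ, hℓ, hℓ, ← h.abs_gap_image hk]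
      rcases lt_or_gt_of_ne hne with hlt | hlt
      · have h3 := h.sorted.gap_span_le (hQ _ hk) (by have := hQ _ hl'; omega) hmin' hmax
        have h4 := h.sorted.left_mono (show τ (κ i) + 1 ≤ κ (i + 1) from hlt)
          (by have := hQ _ hl; omega)
        have h5 := h.sorted.lt (κ (i + 1)) (by have := hQ _ hl; omega)
        linarith
      · have h3 := h.sorted.gap_span_le (hQ _ hk) (by have := hQ _ hl; omega) hmin hmax'
        have h4 := h.sorted.left_mono (show κ (i + 1) + 1 ≤ τ (κ i) from hlt)
          (by have := hQ _ hl'; omega)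
        have h5 := h.sorted.lt (τ (κ i)) (by have := hQ _ hl'; omega)
        linarith
    rw [← hexp _ hk _ hl, ← hexp _ hk _ hl', ← add_mul] at hspan
    have h3 : 0 < Real.exp (φ (β (κ i))) * ℓ (κ i) := mul_pos (Real.exp_pos _) (hℓpos _ hk)
    have h4 : Real.exp (-e (κ i) (κ (i + 1))) + Real.exp (-e (κ i) (τ (κ i))) ≤ 1 := by
      by_contra hcon
      nlinarith
    refine le_trans (add_le_add ?_ ?_) h4
    · exact Real.exp_le_exp.2 (neg_le_neg h1)
    · exact Real.exp_le_exp.2 (neg_le_neg h2)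

/-- If the refinement contains a sufficiently fine cycle which still contains the breakpoints, then
an orbit visiting inner gaps is not neutral. -/
theorem sum_periodic_ne_zero (h : IsRefinement f B φ q u v Q α β π b) {p : ℝ} (hp : f^[q] p = p)
    (horbit : ∀ i < q, ∃ k ∈ innerGaps Q b, b k = i ∧ f^[i] p ∈ Set.Ioo (β k) (α (k + 1)))
    {r : ℕ} {u' v' : ℕ → ℝ} (h' : IsIntervalCycle f r u' v') (hr : 2 * q < r)
    (hsurj : ∀ k < Q, ∃ j < r, Set.Icc (u' j) (v' j) ⊆ Set.Icc (α k) (β k))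
    (hB : ∀ c ∈ B, c ∈ intervalUnion q u v → c ∈ intervalUnion r u' v') :
    ∑ i ∈ Finset.range q, φ (f^[i] p) ≠ 0 := by
  intro hzero
  have hq := h.outer.pos
  obtain ⟨k, hk, hbk, hpk⟩ := horbit 0 hq
  have hkQ : k < Q := by have := (mem_innerGaps.1 hk).1; omega
  obtain ⟨j, hj, hjk⟩ := hsurj k hkQ
  have hy := hjk (⟨le_rfl, (h'.lt j hj).le⟩ : u' j ∈ Set.Icc (u' j) (v' j))
  have hyp : u' j < p := hy.2.trans_lt hpk.1
  have hpI : p ∈ Set.Icc (u 0) (v 0) := hbk ▸ h.gap_subset hk (Set.Ioo_subset_Icc_self hpk)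
  have hyI : u' j ∈ Set.Icc (u 0) (v 0) := hbk ▸ h.block_sub k hkQ hy
  have hI : Set.Icc (u' j) p ⊆ Set.Icc (u 0) (v 0) := Set.Icc_subset_Icc hyI.1 hpI.2
  have hI01 : Set.Icc (u' j) p ⊆ Set.Icc 0 1 := hI.trans (h.outer.sub 0 hq)
  have hq2 : 0 < 2 * q := by omega
  have hpB : ∀ i < q, f^[i] p ∉ B := by
    intro i hi hmem
    obtain ⟨l, hl, -, hpl⟩ := horbit i hi
    exact absurd (hpl.2.trans_le (h.gap_breakpoint hl _ hmem hpl.1)) (lt_irrefl _)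
  obtain ⟨ε, hε, s, hs, haff⟩ := h.logSlope.iterate_affine_near q (h.outer.sub 0 hq hpI) hpB
  rw [hzero, Real.exp_zero] at hs
  have hnear : ∀ x, |x - p| < ε → f^[2 * q] x = x := by
    intro x hx
    have h1 := haff (x - p) hx
    have h2 := haff (s * (x - p)) (by rwa [abs_mul, hs, one_mul])
    have h3 : s * s = 1 := by rw [← abs_mul_abs_self, hs, one_mul]
    rw [hp, add_sub_cancel] at h1
    rw [hp] at h2
    rw [two_mul, Function.iterate_add_apply, h1, h2, ← mul_assoc, h3]
    ring
  set S := {x | x ∈ Set.Icc (u' j) p ∧ f^[2 * q] x ≠ x} with hS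
  have hyS : u' j ∈ S := by
    refine ⟨⟨le_rfl, hyp.le⟩, fun hcon => ?_⟩
    have := h'.le_of_iterate_eq ⟨j, hj, le_rfl, (h'.lt j hj).le⟩ hq2 hcon
    omega
  have hbdd : BddAbove S := ⟨p, fun x hx => hx.1.2⟩
  set z := sSup S with hz
  have hyz : u' j ≤ z := le_csSup hbdd hyS
  have hzp : z ≤ p - ε := by
    refine csSup_le ⟨_, hyS⟩ fun x hx => ?_
    by_contra hcon
    refine hx.2 (hnear x ?_)
    rw [abs_lt]
    constructor <;> linarith [hx.1.2]
  have hright : Set.EqOn f^[2 * q] id (Set.Icc z p) := by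
    have h1 : Set.EqOn f^[2 * q] id (Set.Ioc z p) := by
      intro x hx
      by_contra hcon
      have : x ∈ S := ⟨⟨hyz.trans hx.1.le, hx.2⟩, hcon⟩
      exact absurd (le_csSup hbdd this) (not_le.2 hx.1)
    refine h1.of_subset_closure ?_ continuousOn_id Set.Ioc_subset_Icc_self ?_
    · exact (h.logSlope.cont.iterate h.logSlope.maps _).mono
        ((Set.Icc_subset_Icc_left hyz).trans hI01)
    · rw [closure_Ioc (by linarith)]
  have hzI : z ∈ Set.Icc (u' j) p := ⟨hyz, by linarith⟩
  have hzfix : f^[2 * q] z = z := hright ⟨le_rfl, hzI.2⟩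
  have hzB : ∀ i < 2 * q, f^[i] z ∉ B := by
    intro i _ hmem
    have h1 := hB _ hmem (h.outer.iterate_mem_union ⟨0, hq, hI hzI⟩ i)
    have h2 : f^[2 * q] (f^[i] z) = f^[i] z := by
      rw [← Function.iterate_add_apply, add_comm, Function.iterate_add_apply, hzfix]
    have := h'.le_of_iterate_eq h1 hq2 h2
    omega
  obtain ⟨δ, hδ, s', -, haff'⟩ := h.logSlope.iterate_affine_near (2 * q) (hI01 hzI) hzB
  rw [hzfix] at haff'
  have hη : 0 < min (δ / 2) ε := lt_min (by linarith) hε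
  have hs' : s' = 1 := by
    have h1 := haff' (min (δ / 2) ε)
      (by rw [abs_of_pos hη]; linarith [min_le_left (δ / 2) ε])
    rw [hright ⟨by linarith, by linarith [min_le_right (δ / 2) ε]⟩, id] at h1
    have h2 : (s' - 1) * min (δ / 2) ε = 0 := by linarith
    rcases mul_eq_zero.1 h2 with h3 | h3
    · linarith
    · exact absurd h3 hη.ne'
  obtain ⟨x, hx, hzx⟩ := exists_lt_of_lt_csSup ⟨_, hyS⟩ (show z - δ < z by linarith)
  have hxz : x ≤ z := le_csSup hbdd hx
  refine hx.2 ?_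
  have h1 := haff' (x - z) (by rw [abs_lt]; constructor <;> linarith)
  rwa [hs', one_mul, add_sub_cancel] at h1

end IsRefinement

/-- One renormalization step: comparison of the sums of logarithmic slopes over two nested cycles
and over a periodic orbit separating them. -/
theorem IsLogSlope.exists_periodic_sum {f : ℝ → ℝ} {B : Finset ℝ} {φ : ℝ → ℝ}
    (hf : IsLogSlope f B φ) {q Q r : ℕ} {u v U V u' v' : ℕ → ℝ}
    (h : IsIntervalCycle f q u v) (hQ : IsIntervalCycle f Q U V) (h' : IsIntervalCycle f r u' v')
    (hqQ : q < Q) (hr : 2 * q < r)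
    (hsub : ∀ j < Q, ∃ i < q, Set.Icc (U j) (V j) ⊆ Set.Icc (u i) (v i))
    (hsub' : ∀ j < r, ∃ i < Q, Set.Icc (u' j) (v' j) ⊆ Set.Icc (U i) (V i))
    (hBQ : ∀ c ∈ B, c ∈ intervalUnion q u v → c ∈ intervalUnion Q U V)
    (hBr : ∀ c ∈ B, c ∈ intervalUnion q u v → c ∈ intervalUnion r u' v') :
    ∃ x : ℕ → ℝ, (∀ i < q, x i ∈ Set.Icc (u i) (v i)) ∧ 0 < ∑ i ∈ Finset.range q, φ (x i) ∧
      ∑ i ∈ Finset.range q, φ (v i) ≤ ∑ j ∈ Finset.range Q, φ (V j) ∧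
      (∑ i ∈ Finset.range q, φ (x i) ≤
          ∑ j ∈ Finset.range Q, φ (V j) - ∑ i ∈ Finset.range q, φ (v i) ∨
        Real.exp (-∑ i ∈ Finset.range q, φ (x i)) + Real.exp
          (-(∑ j ∈ Finset.range Q, φ (V j) - ∑ i ∈ Finset.range q, φ (v i))) ≤ 1) := by
  obtain ⟨σ, hσ, hunion, π, hsorted⟩ := hQ.exists_isSortedCycle
  choose! a ha using hsub
  have hR : IsRefinement f B φ q u v Q (U ∘ σ) (V ∘ σ) π (a ∘ σ) := by
    refine ⟨hf, h, hsorted, hqQ, fun k hk => (ha _ ((hσ k).2 hk)).1,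
      fun k hk => (ha _ ((hσ k).2 hk)).2, fun i hi => ?_, fun c hc hcu => hunion ▸ hBQ c hc hcu⟩
    obtain ⟨j, hj, hji⟩ := h.exists_subset hQ (fun j hj => ⟨a j, ha j hj⟩) hi
    have hUj : U j ∈ Set.Icc (U j) (V j) := ⟨le_rfl, (hQ.lt j hj).le⟩
    refine ⟨σ.symm j, (hσ _).1 (by simpa using hj), ?_⟩
    simpa using h.eq_of_mem _ (ha j hj).1 _ hi _ ((ha j hj).2 hUj) (hji hUj)
  have hsum : ∑ k ∈ Finset.range Q, φ ((V ∘ σ) k) = ∑ j ∈ Finset.range Q, φ (V j) :=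
    Finset.sum_bijective σ σ.bijective (by simp [hσ]) fun _ _ => rfl
  obtain ⟨p, hp, horbit⟩ := hR.exists_periodic
  obtain ⟨h1, h2, h3⟩ := hR.sum_periodic hp horbit
  have h4 := hR.sum_periodic_ne_zero hp horbit h' hr
    (fun k hk => hQ.exists_subset h' hsub' ((hσ k).2 hk)) hBr
  have h5 := hR.sum_right_endpoints
  rw [hsum] at h5
  rw [h5, add_sub_cancel_left]
  refine ⟨fun i => f^[i] p, fun i hi => ?_, lt_of_le_of_ne h1 h4.symm, by linarith, h3⟩
  obtain ⟨k, hk, hki, hpk⟩ := horbit i hi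
  have hpu := hR.gap_subset hk (Set.Ioo_subset_Icc_self hpk)
  rwa [hki] at hpu

/-- The real-variable argument excluding infinitely many renormalizations. -/
theorem false_of_monotone_bounded {T m : ℕ → ℝ} {C : ℝ} {D : Set ℝ} (hT : Monotone T)
    (hC : ∀ n, T n ≤ C) (hD : D.Finite) (hmD : ∀ n, m n - T n ∈ D) (hm : ∀ n, 0 < m n)
    (hor : ∀ n, m n ≤ T (n + 1) - T n ∨
      Real.exp (-m n) + Real.exp (-(T (n + 1) - T n)) ≤ 1) : False := by
  obtain ⟨L, hL⟩ : ∃ L, Filter.Tendsto T Filter.atTop (nhds L) :=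
    ⟨_, tendsto_atTop_ciSup hT ⟨C, by rintro _ ⟨n, rfl⟩; exact hC n⟩⟩
  have hM : Filter.Tendsto (fun n => T (n + 1) - T n) Filter.atTop (nhds 0) := by
    simpa using (hL.comp (Filter.tendsto_add_atTop_nat 1)).sub hL
  obtain ⟨K, hK⟩ := hD.bddAbove
  have hmK : ∀ n, m n ≤ K + C := fun n => by linarith [hK (hmD n), hC n]
  have hlim : Filter.Tendsto (fun n => Real.exp (-(T (n + 1) - T n))) Filter.atTop (nhds 1) := by
    simpa [Function.comp_def] using (Real.continuous_exp.tendsto _).comp hM.neg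
  have hev : ∀ᶠ n in Filter.atTop, m n ≤ T (n + 1) - T n := by
    filter_upwards [hlim.eventually_const_lt
      (show 1 - Real.exp (-(K + C)) < 1 by linarith [Real.exp_pos (-(K + C))])] with n hn
    refine (hor n).resolve_right fun hcon => ?_
    have : Real.exp (-(K + C)) ≤ Real.exp (-m n) := Real.exp_le_exp.2 (neg_le_neg (hmK n))
    linarith
  have hm0 : Filter.Tendsto m Filter.atTop (nhds 0) :=
    tendsto_of_tendsto_of_tendsto_of_le_of_le' tendsto_const_nhds hM
      (Filter.Eventually.of_forall fun n => (hm n).le) hev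
  have hd : Filter.Tendsto (fun n => m n - T n) Filter.atTop (nhds (-L)) := by
    simpa using hm0.sub hL
  have hnhds : (D \ {-L})ᶜ ∈ nhds (-L) :=
    (hD.subset Set.sdiff_subset).isClosed.isOpen_compl.mem_nhds (by simp)
  obtain ⟨n, hn⟩ := (hd.eventually_mem hnhds).exists
  have hnL : m n - T n = -L := by
    by_contra hcon
    exact hn ⟨hmD n, hcon⟩
  linarith [hm n, hT.ge_of_tendsto hL n]

theorem IsLogSlope.not_infinitely_renormalizable {f : ℝ → ℝ} {B : Finset ℝ} {φ : ℝ → ℝ}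
    (hf : IsLogSlope f B φ) {q : ℕ → ℕ} {u v : ℕ → ℕ → ℝ} (hq : StrictMono q)
    (h : ∀ n, IsIntervalCycle f (q n) (u n) (v n))
    (hsub : ∀ n, ∀ j < q (n + 1), ∃ i < q n,
      Set.Icc (u (n + 1) j) (v (n + 1) j) ⊆ Set.Icc (u n i) (v n i)) : False := by
  have hsub' : ∀ n m, n ≤ m → ∀ j < q m, ∃ i < q n,
      Set.Icc (u m j) (v m j) ⊆ Set.Icc (u n i) (v n i) := by
    intro n m hnm
    induction m, hnm using Nat.le_induction with
    | base => exact fun j hj => ⟨j, hj, subset_rfl⟩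
    | succ m _ ih =>
      intro j hj
      obtain ⟨k, hk, hjk⟩ := hsub m j hj
      obtain ⟨i, hi, hki⟩ := ih k hk
      exact ⟨i, hi, hjk.trans hki⟩
  have hanti : ∀ n m, n ≤ m →
      intervalUnion (q m) (u m) (v m) ⊆ intervalUnion (q n) (u n) (v n) := by
    rintro n m hnm x ⟨j, hj, hx⟩
    obtain ⟨i, hi, hji⟩ := hsub' n m hnm j hj
    exact ⟨i, hi, hji hx⟩
  have hstable : ∀ c, ∃ n, c ∈ intervalUnion (q n) (u n) (v n) →
      ∀ m, c ∈ intervalUnion (q m) (u m) (v m) := by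
    intro c
    by_cases hc : ∀ m, c ∈ intervalUnion (q m) (u m) (v m)
    · exact ⟨0, fun _ => hc⟩
    · push Not at hc
      obtain ⟨n, hn⟩ := hc
      exact ⟨n, fun hcn => absurd hcn hn⟩
  choose ν hν using hstable
  set N := B.sup ν with hN
  have hB : ∀ n m, ∀ c ∈ B, c ∈ intervalUnion (q (N + n)) (u (N + n)) (v (N + n)) →
      c ∈ intervalUnion (q m) (u m) (v m) := fun n m c hc hcn =>
    hν c (hanti _ _ ((Finset.le_sup hc).trans (Nat.le_add_right N n)) hcn) m
  obtain ⟨C, hC⟩ := hf.exists_sum_le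
  obtain ⟨D, hD, hsum⟩ := hf.exists_finite_sum_sub
  have hstep := fun n => hf.exists_periodic_sum (h (N + n)) (h (N + n + 1))
    (h (N + n + 1 + 2 * q (N + n) + 1)) (hq (Nat.lt_succ_self _))
    (lt_of_lt_of_le (by omega) (hq.le_apply (x := N + n + 1 + 2 * q (N + n) + 1)))
    (hsub _) (hsub' _ _ (by omega)) (hB n _) (hB n _)
  choose x hx hpos hle hor using hstep
  exact false_of_monotone_bounded
    (T := fun n => ∑ i ∈ Finset.range (q (N + n)), φ (v (N + n) i))
    (monotone_nat_of_le_succ hle) (fun n => hC _ _ _ (h (N + n))) hD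
    (fun n => hsum _ _ _ (h (N + n)) (x n) (hx n)) hpos hor

/-- **Theorem C.** No piecewise affine map of `[0,1]` is infinitely renormalizable:
there is no `f ∈ PL([0,1])` admitting an infinite sequence of nested cycles
`𝓘¹ ⊃ 𝓘² ⊃ 𝓘³ ⊃ ⋯` with strictly increasing numbers of intervals `2 ≤ q₁ < q₂ < ⋯`. -/
theorem no_infinitely_renormalizable_PL :
    ¬ ∃ f : ℝ → ℝ, IsPLMap f ∧
      ∃ (q : ℕ → ℕ) (I : ℕ → ℕ → Set ℝ),
        2 ≤ q 0 ∧ StrictMono q ∧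
        (∀ n, IsCycle f (q n) (I n)) ∧
        (∀ n, CycleNested (q n) (I n) (q (n + 1)) (I (n + 1))) := by
  rintro ⟨f, hf, q, I, -, hq, hI, hnest⟩
  obtain ⟨B, φ, hφ⟩ := hf.exists_isLogSlope
  choose u v h hIuv using fun n => (hI n).exists_isIntervalCycle
  refine hφ.not_infinitely_renormalizable hq h fun n j hj => ?_
  obtain ⟨i, hi, hji⟩ := (hnest n).1 j hj
  rw [hIuv _ j hj, hIuv n i hi] at hji
  exact ⟨i, hi, hji⟩
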